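/- arXiv:2410.15488 — 4 statements merged into one kernel-verified Lean document; each statement's English description precedes it below -/
import Mathlib

section
/- Let Z be a metric space on which a group G acts by isometries, let z ∈ Z, and suppose the orbit A = G•z is a closed subset of Z. Assume Z is non-branching. Let σ : [0,∞) → Z be a horizontal ray at z, i.e., an isometric embedding with σ(0) = z and dist(σ(t), A) = t for all t ≥ 0. Then for every t > 0, σ restricted to [0,t] is the unique minimal geodesic from A to σ(t): any isometric embedding α : [0,t] → Z with α(0) ∈ A and α(t) = σ(t) satisfies α(s) = σ(s) for all s ∈ [0,t]; in particular α(0) = z. -/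
/-- A metric space is non-branching if any two unit-speed geodesics `γ₁ γ₂ : [a,b] → Z`
that agree on a subinterval of positive length agree on all of `[a,b]`. -/
def NonBranching (Z : Type*) [MetricSpace Z] : Prop :=
  ∀ (a b : ℝ), a < b → ∀ γ₁ γ₂ : ℝ → Z,
    (∀ s ∈ Set.Icc a b, ∀ t ∈ Set.Icc a b, dist (γ₁ s) (γ₁ t) = |s - t|) →
    (∀ s ∈ Set.Icc a b, ∀ t ∈ Set.Icc a b, dist (γ₂ s) (γ₂ t) = |s - t|) →
    (∃ c d : ℝ, a ≤ c ∧ c < d ∧ d ≤ b ∧ ∀ s ∈ Set.Icc c d, γ₁ s = γ₂ s) →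
    ∀ s ∈ Set.Icc a b, γ₁ s = γ₂ s

/-- In a non-branching metric space with an isometric group action whose
orbit `A = G•z` is closed, any horizontal ray `σ` at `z` is, on each `[0,t]`, the unique
minimal geodesic from `A` to `σ(t)`. -/
theorem stmt3 {Z G : Type*} [MetricSpace Z] [Group G] [MulAction G Z]
    (hiso : ∀ g : G, Isometry (fun x : Z => g • x))
    (z : Z) (hA : IsClosed (MulAction.orbit G z))
    (hnb : NonBranching Z)
    (σ : ℝ → Z)
    (hσray : ∀ s t : ℝ, 0 ≤ s → 0 ≤ t → dist (σ s) (σ t) = |s - t|)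
    (hσ0 : σ 0 = z)
    (hσdist : ∀ t : ℝ, 0 ≤ t → Metric.infDist (σ t) (MulAction.orbit G z) = t) :
    ∀ t : ℝ, 0 < t → ∀ α : ℝ → Z,
      (∀ s ∈ Set.Icc (0 : ℝ) t, ∀ u ∈ Set.Icc (0 : ℝ) t, dist (α s) (α u) = |s - u|) →
      α 0 ∈ MulAction.orbit G z → α t = σ t →
      ∀ s ∈ Set.Icc (0 : ℝ) t, α s = σ s := by
  intro t ht α hα hα0 hαt
  have key : ∀ s u : ℝ, 0 ≤ s → s ≤ t → t ≤ u → dist (α s) (σ u) = u - s := by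
    intro s u hs hst htu
    have h1 : dist (α s) (σ u) ≤ dist (α s) (α t) + dist (α t) (σ u) := dist_triangle _ _ _
    have h2 : dist (σ u) (α 0) ≤ dist (σ u) (α s) + dist (α s) (α 0) := dist_triangle _ _ _
    have h3 := Metric.infDist_le_dist_of_mem (x := σ u) hα0
    rw [hσdist u (by linarith)] at h3
    rw [hα s ⟨hs, hst⟩ t ⟨ht.le, le_refl t⟩, hαt, hσray t u ht.le (by linarith),
      abs_of_nonpos (by linarith), abs_of_nonpos (by linarith)] at h1
    rw [hα s ⟨hs, hst⟩ 0 ⟨le_refl 0, ht.le⟩, abs_of_nonneg (by linarith),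
      dist_comm (σ u) (α s)] at h2
    linarith
  have hmain := hnb 0 (t + 1) (by linarith) (fun s => if s ≤ t then α s else σ s) σ
    (by
      intro s hs u hu
      by_cases h1 : s ≤ t <;> by_cases h2 : u ≤ t <;> simp only [h1, h2, if_true, if_false]
      · exact hα s ⟨hs.1, h1⟩ u ⟨hu.1, h2⟩
      · rw [key s u hs.1 h1 (by linarith), abs_of_nonpos (by linarith)]
        ring
      · rw [dist_comm, key u s hu.1 h2 (by linarith), abs_of_nonneg (by linarith)]
      · exact hσray s u hs.1 hu.1)
    (fun s hs u hu => hσray s u hs.1 hu.1)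
    ⟨t, t + 1, ht.le, by linarith, le_refl _, by
      intro s hs
      by_cases h1 : s ≤ t
      · have h : s = t := le_antisymm h1 hs.1
        subst h
        simpa using hαt
      · simp [h1]⟩
  intro s hs
  have h := hmain s ⟨hs.1, by linarith [hs.2]⟩
  simpa [hs.2] using h
end

section
/- Let Z be a metric space on which a group G acts by isometries, let z ∈ Z, and suppose the orbit G•z is a closed subset of Z. Assume Z is non-branching, and assume additionally that for all a, b ∈ Z with dist(a, G•z) = dist(b, G•z) there exists g ∈ G with g•a = b. Let σ, β : [0,∞) → Z be two horizontal rays at z, i.e., isometric embeddings with σ(0) = β(0) = z and dist(σ(t), G•z) = dist(β(t), G•z) = t for all t ≥ 0. Then there exists h ∈ G with h•z = z and β(t) = h•σ(t) for all t ≥ 0. -/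
/-- In a non-branching metric space with an isometric group action whose
orbit `G•z` is closed, acting transitively on level sets of the distance to the orbit,
any two horizontal rays at `z` differ by an element of the isotropy group at `z`. -/
theorem stmt4 {Z G : Type*} [MetricSpace Z] [Group G] [MulAction G Z]
    (hiso : ∀ g : G, Isometry (fun x : Z => g • x))
    (z : Z) (hA : IsClosed (MulAction.orbit G z))
    (hnb : NonBranching Z)
    (htrans : ∀ a b : Z,
      Metric.infDist a (MulAction.orbit G z) = Metric.infDist b (MulAction.orbit G z) →
      ∃ g : G, g • a = b)
    (σ β : ℝ → Z)
    (hσray : ∀ s t : ℝ, 0 ≤ s → 0 ≤ t → dist (σ s) (σ t) = |s - t|)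
    (hβray : ∀ s t : ℝ, 0 ≤ s → 0 ≤ t → dist (β s) (β t) = |s - t|)
    (hσ0 : σ 0 = z) (hβ0 : β 0 = z)
    (hσdist : ∀ t : ℝ, 0 ≤ t → Metric.infDist (σ t) (MulAction.orbit G z) = t)
    (hβdist : ∀ t : ℝ, 0 ≤ t → Metric.infDist (β t) (MulAction.orbit G z) = t) :
    ∃ h : G, h • z = z ∧ ∀ t : ℝ, 0 ≤ t → β t = h • σ t := by
  obtain ⟨h, hh⟩ := htrans (σ 1) (β 1)
    (by rw [hσdist 1 zero_le_one, hβdist 1 zero_le_one])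
  have hinv : ∀ x : Z, Metric.infDist (h • x) (MulAction.orbit G z)
      = Metric.infDist x (MulAction.orbit G z) := by
    intro x
    have h1 := Metric.infDist_image (hiso h) (x := x) (t := MulAction.orbit G z)
    have h2 : (fun x : Z => h • x) '' MulAction.orbit G z = MulAction.orbit G z :=
      MulAction.smul_orbit h z
    rw [h2] at h1
    exact h1
  have hray : ∀ s t : ℝ, 0 ≤ s → 0 ≤ t → dist (h • σ s) (h • σ t) = |s - t| := by
    intro s t hs ht
    rw [← hσray s t hs ht]
    exact (hiso h).dist_eq _ _
  have key : ∀ s t : ℝ, 0 ≤ s → s ≤ 1 → 1 ≤ t → dist (β s) (h • σ t) = t - s := by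
    intro s t hs hs1 ht
    apply le_antisymm
    · have h1 := dist_triangle (β s) (β 1) (h • σ t)
      rw [hβray s 1 hs zero_le_one] at h1
      rw [← hh] at h1
      rw [hray 1 t zero_le_one (by linarith), abs_of_nonpos (by linarith),
        abs_of_nonpos (by linarith)] at h1
      linarith
    · have h1 := Metric.infDist_le_infDist_add_dist (s := MulAction.orbit G z)
        (x := h • σ t) (y := β s)
      rw [hinv, hσdist t (by linarith), hβdist s hs, dist_comm] at h1
      linarith
  let c : ℝ → Z := fun t => if t ≤ 1 then β t else h • σ t
  have hc : ∀ T : ℝ, ∀ s ∈ Set.Icc 0 T, ∀ t ∈ Set.Icc 0 T, dist (c s) (c t) = |s - t| := by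
    intro T s hs t ht
    simp only [c]
    split_ifs with h1 h2 h2
    · exact hβray s t hs.1 ht.1
    · rw [key s t hs.1 h1 (by linarith), abs_of_nonpos (by linarith)]; ring
    · rw [dist_comm, key t s ht.1 h2 (by linarith), abs_of_nonneg (by linarith)]
    · exact hray s t hs.1 ht.1
  have hE : ∀ s ∈ Set.Icc (0 : ℝ) 2, c s = h • σ s := by
    refine hnb 0 2 (by norm_num) c (fun t => h • σ t) (hc 2)
      (fun s hs t ht => hray s t hs.1 ht.1) ⟨1, 2, by norm_num, by norm_num, le_rfl, ?_⟩
    intro s hs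
    simp only [c]
    split_ifs with h1
    · have : s = 1 := le_antisymm h1 hs.1
      subst this
      exact hh.symm
    · rfl
  have hE1 : ∀ s : ℝ, 0 ≤ s → s ≤ 1 → β s = h • σ s := by
    intro s h0 h1
    have := hE s ⟨h0, by linarith⟩
    simpa only [c, if_pos h1] using this
  refine ⟨h, ?_, ?_⟩
  · have := hE1 0 le_rfl zero_le_one
    rw [hσ0, hβ0] at this
    exact this.symm
  · intro t ht
    refine hnb 0 (t + 1) (by linarith) β (fun t => h • σ t)
      (fun s hs t ht => hβray s t hs.1 ht.1)
      (fun s hs t ht => hray s t hs.1 ht.1)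
      ⟨0, 1, le_rfl, by norm_num, by linarith, fun s hs => hE1 s hs.1 hs.2⟩ t ⟨ht, by linarith⟩
end

section
/- Let Y be a proper metric space (every closed bounded subset of Y is compact) and let A ⊆ Y be a nonempty closed subset. Assume that for every x ∈ Y there exists a unique isometric embedding γ_x : [0,∞) → Y such that dist(γ_x(t), A) = t for all t ≥ 0 and γ_x(dist(x,A)) = x. Then the map s : Y → Y defined by s(x) = γ_x(1) is continuous. -/
/-- In a proper metric space, if through every point `x` there is a unique
horizontal ray `Γ x` with respect to a nonempty closed set `A` (i.e. an isometric
embedding of `[0,∞)` with `dist(Γ x t, A) = t` passing through `x` at time `dist(x,A)`),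
then the selection map `x ↦ Γ x 1` is continuous. -/
theorem stmt6 {Y : Type*} [MetricSpace Y] [ProperSpace Y]
    (A : Set Y) (hA : A.Nonempty) (hAclosed : IsClosed A)
    (Γ : Y → ℝ → Y)
    (hray : ∀ x : Y, ∀ s t : ℝ, 0 ≤ s → 0 ≤ t → dist (Γ x s) (Γ x t) = |s - t|)
    (hdist : ∀ x : Y, ∀ t : ℝ, 0 ≤ t → Metric.infDist (Γ x t) A = t)
    (hthrough : ∀ x : Y, Γ x (Metric.infDist x A) = x)
    (huniq : ∀ x : Y, ∀ γ : ℝ → Y,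
      (∀ s t : ℝ, 0 ≤ s → 0 ≤ t → dist (γ s) (γ t) = |s - t|) →
      (∀ t : ℝ, 0 ≤ t → Metric.infDist (γ t) A = t) →
      γ (Metric.infDist x A) = x →
      ∀ t : ℝ, 0 ≤ t → γ t = Γ x t) :
    Continuous (fun x : Y => Γ x 1) := by
  classical
  rw [continuous_iff_continuousAt]
  intro x
  rw [ContinuousAt, Filter.tendsto_iff_ultrafilter]
  intro g hg
  have hid : Filter.Tendsto (fun y : Y => y) (g : Filter Y) (nhds x) := hg
  have hd : Filter.Tendsto (fun y : Y => Metric.infDist y A) (g : Filter Y)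
      (nhds (Metric.infDist x A)) :=
    ((Metric.continuous_infDist_pt A).tendsto x).comp hid
  have hbd : ∀ t : ℝ, 0 ≤ t → ∀ y : Y,
      dist (Γ y t) y = |t - Metric.infDist y A| := by
    intro t ht y
    have h := hray y t (Metric.infDist y A) ht Metric.infDist_nonneg
    rwa [hthrough y] at h
  have hlim : ∀ t : ℝ, ∃ z : Y, 0 ≤ t →
      Filter.Tendsto (fun y => Γ y t) (g : Filter Y) (nhds z) := by
    intro t
    by_cases ht : 0 ≤ t
    · have hev : ∀ᶠ y in (g : Filter Y),
          Γ y t ∈ Metric.closedBall x (|t - Metric.infDist x A| + 1) := by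
        have h1 : Filter.Tendsto (fun y : Y => |t - Metric.infDist y A| + dist y x)
            (g : Filter Y) (nhds (|t - Metric.infDist x A| + dist x x)) :=
          ((tendsto_const_nhds.sub hd).abs).add (hid.dist tendsto_const_nhds)
        rw [dist_self, add_zero] at h1
        filter_upwards [h1.eventually_lt_const (lt_add_one _)] with y hy
        rw [Metric.mem_closedBall]
        have := dist_triangle (Γ y t) y x
        rw [hbd t ht y] at this
        linarith
      obtain ⟨z, -, hz⟩ := (isCompact_closedBall x (|t - Metric.infDist x A| + 1)).ultrafilter_le_nhds
        (g.map (fun y => Γ y t)) (Filter.le_principal_iff.2 hev)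
      exact ⟨z, fun _ => hz⟩
    · exact ⟨x, fun h => absurd h ht⟩
  choose γ hγ using hlim
  have key := huniq x γ ?_ ?_ ?_ 1 zero_le_one
  · have := hγ 1 zero_le_one
    rwa [key] at this
  · intro s t hs ht
    refine tendsto_nhds_unique ((hγ s hs).dist (hγ t ht)) ?_
    simp only [hray _ s t hs ht]
    exact tendsto_const_nhds
  · intro t ht
    refine tendsto_nhds_unique
      (((Metric.continuous_infDist_pt A).tendsto _).comp (hγ t ht)) ?_
    refine tendsto_const_nhds.congr (fun y => ?_)
    exact (hdist y t ht).symm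
  · have h0 : 0 ≤ Metric.infDist x A := Metric.infDist_nonneg
    have h1 := (hγ _ h0).dist hid
    simp only [hbd _ h0] at h1
    have h2 : Filter.Tendsto (fun y : Y => |Metric.infDist x A - Metric.infDist y A|)
        (g : Filter Y) (nhds |Metric.infDist x A - Metric.infDist x A|) :=
      (tendsto_const_nhds.sub hd).abs
    have h3 := tendsto_nhds_unique h1 h2
    rw [sub_self, abs_zero] at h3
    exact dist_eq_zero.1 h3
end

section
/- Let (Q, 𝔮) be a measure space and let H : Q × ℝ → ℝ be a function such that: (i) for every r < 0 the function α ↦ H(α, r) is 𝔮-integrable and nonnegative 𝔮-almost everywhere; (ii) for 𝔮-almost every α ∈ Q the function r ↦ H(α, r) is non-increasing on (−∞, 0); and (iii) ∫_Q H(α, r) d𝔮(α) = 1 for every r < 0. Then for 𝔮-almost every α ∈ Q, the function r ↦ H(α, r) is constant on (−∞, 0). -/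
open MeasureTheory

/-- If `H(α, ·)` is non-increasing on `(−∞,0)` for a.e. `α`, nonnegative,
integrable in `α` for each `r < 0`, and has constant total integral `1`, then for a.e.
`α` the function `r ↦ H(α,r)` is constant on `(−∞,0)`. -/
theorem stmt8 {Q : Type*} [MeasurableSpace Q] (q : Measure Q)
    (H : Q → ℝ → ℝ)
    (hint : ∀ r : ℝ, r < 0 → Integrable (fun α => H α r) q)
    (hnonneg : ∀ r : ℝ, r < 0 → ∀ᵐ α ∂q, 0 ≤ H α r)
    (hmono : ∀ᵐ α ∂q, ∀ r s : ℝ, r ≤ s → s < 0 → H α s ≤ H α r)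
    (hone : ∀ r : ℝ, r < 0 → ∫ α, H α r ∂q = 1) :
    ∀ᵐ α ∂q, ∀ r s : ℝ, r < 0 → s < 0 → H α r = H α s := by
  have key : ∀ p : ℚ × ℚ, ∀ᵐ α ∂q, (p.1 : ℝ) ≤ p.2 → (p.2 : ℝ) < 0 →
      H α p.2 = H α p.1 := by
    intro p
    by_cases h1 : (p.1 : ℝ) ≤ p.2
    · by_cases h2 : (p.2 : ℝ) < 0
      · have h3 : (p.1 : ℝ) < 0 := lt_of_le_of_lt h1 h2
        have hle : (fun α => H α p.2) ≤ᵐ[q] (fun α => H α p.1) := by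
          filter_upwards [hmono] with α hα
          exact hα _ _ h1 h2
        have heq := (integral_eq_iff_of_ae_le (hint _ h2) (hint _ h3) hle).1
          ((hone _ h2).trans (hone _ h3).symm)
        filter_upwards [heq] with α hα _ _
        exact hα
      · exact Filter.Eventually.of_forall fun α _ h => absurd h h2
    · exact Filter.Eventually.of_forall fun α h => absurd h h1
  filter_upwards [ae_all_iff.2 key, hmono] with α hk hm r s hr hs
  obtain ⟨a, -, ha⟩ : ∃ a : ℚ, min r s - 1 < a ∧ (a : ℝ) < min r s :=
    exists_rat_btwn (by linarith)
  obtain ⟨b, hb, hb0⟩ : ∃ b : ℚ, max r s < b ∧ (b : ℝ) < 0 :=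
    exists_rat_btwn (max_lt hr hs)
  have har := ha.trans_le (min_le_left r s)
  have has := ha.trans_le (min_le_right r s)
  have hbr := (le_max_left r s).trans_lt hb
  have hbs := (le_max_right r s).trans_lt hb
  have e := hk (a, b) (har.trans hbr).le hb0
  have e1 := hm _ _ har.le hr
  have e2 := hm _ _ has.le hs
  have e3 := hm _ _ hbr.le hb0
  have e4 := hm _ _ hbs.le hb0
  simp only at e
  linarith
end
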